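/- arXiv:2310.04073 — 4 statements merged into one kernel-verified Lean document; each statement's English description precedes it below -/
import Mathlib

section
/- Let f : ℂ² → ℝ be a C¹ function with differential d_zf at z and L := d₀f, let χ : ℂ² → ℝ be a C¹ function with values in [0,1], and let D ≥ 1 be a constant such that for all z in the closed unit ball B₁ of ℂ² one has ‖d_zχ‖ ≤ D, |f(z) − (f(0) + L(z))| ≤ D‖z‖², and ‖d_zf − L‖ ≤ D‖z‖. For 0 < r ≤ 1 define h_r(z) := χ(z/r)·f(z) + (1 − χ(z/r))·(f(0) + L(z)). Then for every z with ‖z‖ ≤ r, the differential of h_r at z satisfies ‖d_z h_r − L‖ ≤ (D + D²) r. -/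
/-- On the ball of radius `r`, the differential of the interpolation `h_r`
is within `(D + D²) r` of `L = d₀f` in operator norm. -/
theorem stmt_1
    (f χ : EuclideanSpace ℂ (Fin 2) → ℝ) (D : ℝ)
    (hf : ContDiff ℝ 1 f)
    (hχsmooth : ContDiff ℝ 1 χ)
    (hχ : ∀ z, 0 ≤ χ z ∧ χ z ≤ 1)
    (hD : 1 ≤ D)
    (hχd : ∀ z : EuclideanSpace ℂ (Fin 2), ‖z‖ ≤ 1 → ‖fderiv ℝ χ z‖ ≤ D)
    (hquad : ∀ z : EuclideanSpace ℂ (Fin 2), ‖z‖ ≤ 1 →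
      |f z - (f 0 + fderiv ℝ f 0 z)| ≤ D * ‖z‖ ^ 2)
    (hfd : ∀ z : EuclideanSpace ℂ (Fin 2), ‖z‖ ≤ 1 →
      ‖fderiv ℝ f z - fderiv ℝ f 0‖ ≤ D * ‖z‖)
    (r : ℝ) (hr0 : 0 < r) (hr1 : r ≤ 1)
    (h : EuclideanSpace ℂ (Fin 2) → ℝ)
    (hh : ∀ z, h z = χ (r⁻¹ • z) * f z + (1 - χ (r⁻¹ • z)) * (f 0 + fderiv ℝ f 0 z)) :
    ∀ z : EuclideanSpace ℂ (Fin 2), ‖z‖ ≤ r →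
      ‖fderiv ℝ h z - fderiv ℝ f 0‖ ≤ (D + D ^ 2) * r := by
  intro z hz
  have hz1 : ‖z‖ ≤ 1 := hz.trans hr1
  have hw : ‖r⁻¹ • z‖ ≤ 1 := by
    rw [norm_smul, norm_inv, Real.norm_of_nonneg hr0.le, inv_mul_le_one₀ hr0]
    exact hz
  have hfz := (hf.differentiable one_ne_zero z).hasFDerivAt
  have hχz : HasFDerivAt (fun y => χ (r⁻¹ • y)) (r⁻¹ • fderiv ℝ χ (r⁻¹ • z)) z := by
    refine ((hχsmooth.differentiable one_ne_zero (r⁻¹ • z)).hasFDerivAt.comp z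
      ((hasFDerivAt_id (𝕜 := ℝ) z).const_smul r⁻¹)).congr_fderiv ?_
    rw [ContinuousLinearMap.comp_smul, ContinuousLinearMap.comp_id]
  have hL : HasFDerivAt (fun y => f 0 + fderiv ℝ f 0 y) (fderiv ℝ f 0) z :=
    (fderiv ℝ f 0).hasFDerivAt.const_add (f 0)
  have hd : fderiv ℝ h z - fderiv ℝ f 0 =
      χ (r⁻¹ • z) • (fderiv ℝ f z - fderiv ℝ f 0) +
        (f z - (f 0 + fderiv ℝ f 0 z)) • r⁻¹ • fderiv ℝ χ (r⁻¹ • z) := by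
    have hform : h = fun y => (f 0 + fderiv ℝ f 0 y) +
        χ (r⁻¹ • y) * (f y - (f 0 + fderiv ℝ f 0 y)) := by
      funext y
      rw [hh]
      ring
    have key := hL.fun_add (hχz.fun_mul (hfz.fun_sub hL))
    rw [← hform] at key
    rw [key.fderiv, add_sub_cancel_left]
  have hD0 : 0 ≤ D := zero_le_one.trans hD
  have hfirst : ‖χ (r⁻¹ • z) • (fderiv ℝ f z - fderiv ℝ f 0)‖ ≤ D * r := by
    rw [norm_smul, Real.norm_of_nonneg (hχ _).1]
    calc _ ≤ 1 * (D * r) := by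
          gcongr
          · exact (hχ _).2
          · exact (hfd z hz1).trans (by gcongr)
      _ = D * r := one_mul _
  have hsecond : ‖(f z - (f 0 + fderiv ℝ f 0 z)) • r⁻¹ • fderiv ℝ χ (r⁻¹ • z)‖
      ≤ D ^ 2 * r := by
    rw [norm_smul, norm_smul, norm_inv, Real.norm_of_nonneg hr0.le, Real.norm_eq_abs]
    calc _ ≤ (D * r ^ 2) * (r⁻¹ * D) := by
          gcongr
          · exact (hquad z hz1).trans (by gcongr)
          · exact hχd _ hw
      _ = D ^ 2 * r := by
          field_simp
  rw [hd, add_mul]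
  exact norm_add_le_of_le hfirst hsecond
end

section
/- Let f : ℂ² → ℝ be a C¹ function with differential d_zf at z and L := d₀f, let χ : ℂ² → ℝ be a C¹ function with values in [0,1], and let D ≥ 1 be a constant such that for all z in the closed unit ball B₁ of ℂ² one has ‖d_zχ‖ ≤ D, |f(z) − (f(0) + L(z))| ≤ D‖z‖², and ‖d_zf − L‖ ≤ D‖z‖. Assume L ≠ 0. Then for every r with 0 < r ≤ 1 and r < ‖L‖/(D + D²), the function h_r(z) := χ(z/r)·f(z) + (1 − χ(z/r))·(f(0) + L(z)) has no critical point in the closed ball of radius r: d_z h_r ≠ 0 for all z with ‖z‖ ≤ r. -/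
/-- The differential of the interpolation `χ (c • z) * f z + (1 - χ (c • z)) * (a + L z)` between
`f` and the affine function `a + L`. -/
theorem hasFDerivAt_interpolation {E : Type*} [NormedAddCommGroup E] [NormedSpace ℝ E]
    {f χ : E → ℝ} {f' χ' : E →L[ℝ] ℝ} {c : ℝ} {z : E} (hf : HasFDerivAt f f' z)
    (hχ : HasFDerivAt χ χ' (c • z)) (a : ℝ) (L : E →L[ℝ] ℝ) :
    HasFDerivAt (fun z ↦ χ (c • z) * f z + (1 - χ (c • z)) * (a + L z))
      (L + (χ (c • z) • (f' - L) + ((f z - (a + L z)) * c) • χ')) z := by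
  have hχc : HasFDerivAt (fun z ↦ χ (c • z)) (χ'.comp (c • ContinuousLinearMap.id ℝ E)) z :=
    hχ.comp z ((hasFDerivAt_id z).const_smul c)
  have hA : HasFDerivAt (fun z ↦ a + L z) L z := L.hasFDerivAt.const_add a
  refine ((hχc.mul hf).add ((hχc.const_sub 1).mul hA)).congr_fderiv ?_
  ext v
  simp
  ring

/-- If `L = d₀f ≠ 0` and `r < ‖L‖/(D + D²)`, then the interpolation `h_r`
has no critical point in the closed ball of radius `r`. -/
theorem stmt_2
    (f χ : EuclideanSpace ℂ (Fin 2) → ℝ) (D : ℝ)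
    (hf : ContDiff ℝ 1 f)
    (hχsmooth : ContDiff ℝ 1 χ)
    (hχ : ∀ z, 0 ≤ χ z ∧ χ z ≤ 1)
    (hD : 1 ≤ D)
    (hχd : ∀ z : EuclideanSpace ℂ (Fin 2), ‖z‖ ≤ 1 → ‖fderiv ℝ χ z‖ ≤ D)
    (hquad : ∀ z : EuclideanSpace ℂ (Fin 2), ‖z‖ ≤ 1 →
      |f z - (f 0 + fderiv ℝ f 0 z)| ≤ D * ‖z‖ ^ 2)
    (hfd : ∀ z : EuclideanSpace ℂ (Fin 2), ‖z‖ ≤ 1 →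
      ‖fderiv ℝ f z - fderiv ℝ f 0‖ ≤ D * ‖z‖)
    (hL : fderiv ℝ f 0 ≠ 0)
    (r : ℝ) (hr0 : 0 < r) (hr1 : r ≤ 1)
    (hrsmall : r < ‖fderiv ℝ f 0‖ / (D + D ^ 2))
    (h : EuclideanSpace ℂ (Fin 2) → ℝ)
    (hh : ∀ z, h z = χ (r⁻¹ • z) * f z + (1 - χ (r⁻¹ • z)) * (f 0 + fderiv ℝ f 0 z)) :
    ∀ z : EuclideanSpace ℂ (Fin 2), ‖z‖ ≤ r → fderiv ℝ h z ≠ 0 := by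
  intro z hz hcrit
  set L := fderiv ℝ f 0
  have hz1 : ‖z‖ ≤ 1 := hz.trans hr1
  have hw : ‖r⁻¹ • z‖ ≤ 1 := by
    rw [norm_smul, Real.norm_of_nonneg (inv_nonneg.2 hr0.le), inv_mul_le_iff₀ hr0]
    simpa using hz
  have hder := hasFDerivAt_interpolation (hf.differentiable one_ne_zero z).hasFDerivAt
    (hχsmooth.differentiable one_ne_zero (r⁻¹ • z)).hasFDerivAt (f 0) L
  rw [← funext hh] at hder
  have hL_eq := eq_neg_of_add_eq_zero_left (hder.fderiv.symm.trans hcrit)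
  have hD0 : 0 ≤ D := zero_le_one.trans hD
  have hfirst : ‖χ (r⁻¹ • z) • (fderiv ℝ f z - L)‖ ≤ D * r := by
    rw [norm_smul, Real.norm_of_nonneg (hχ _).1]
    calc χ (r⁻¹ • z) * ‖fderiv ℝ f z - L‖ ≤ 1 * (D * ‖z‖) := by
          gcongr
          exacts [(hχ _).2, hfd z hz1]
      _ ≤ D * r := by rw [one_mul]; gcongr
  have hsecond : ‖((f z - (f 0 + L z)) * r⁻¹) • fderiv ℝ χ (r⁻¹ • z)‖ ≤ D ^ 2 * r := by
    rw [norm_smul, norm_mul, Real.norm_of_nonneg (inv_nonneg.2 hr0.le), Real.norm_eq_abs]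
    calc |f z - (f 0 + L z)| * r⁻¹ * ‖fderiv ℝ χ (r⁻¹ • z)‖ ≤ D * r ^ 2 * r⁻¹ * D := by
          gcongr
          · exact (hquad z hz1).trans (by gcongr)
          · exact hχd _ hw
      _ = D ^ 2 * r := by field_simp
  have hle : ‖L‖ ≤ D * r + D ^ 2 * r := by
    rw [hL_eq, norm_neg]
    exact norm_add_le_of_le hfirst hsecond
  rw [lt_div_iff₀ (by positivity)] at hrsmall
  linarith
end

section
/- In the hyperbolic plane ℍ (the upper half-plane with its hyperbolic distance), for any two points a, b ∈ ℍ there exists a unique point m ∈ ℍ minimizing the function z ↦ dist(a, z)² + dist(b, z)² over ℍ; this minimizer m satisfies dist(a, m) = dist(b, m) = dist(a, b)/2, and the minimal value is dist(a, m)² + dist(b, m)² = dist(a, b)²/2. (Equivalently: the nearest point to (a, b) on the diagonal of ℍ × ℍ, for the ℓ²-product metric, is (m, m) where m is the midpoint of the geodesic from a to b.) -/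
open UpperHalfPlane

theorem Real.cosh_eq_two_mul_cosh_half_sq_sub_one (x : ℝ) :
    Real.cosh x = 2 * Real.cosh (x / 2) ^ 2 - 1 := by
  have h := Real.cosh_two_mul (x / 2)
  rw [mul_div_cancel₀ x (two_ne_zero' ℝ), Real.sinh_sq] at h
  linarith

/-- In the hyperbolic plane, `cosh (dist a z) + cosh (dist b z)` is a multiple of
`cosh (dist m z)` for a point `m` depending only on `a` and `b` (in the hyperboloid model,
the normalization of `a + b`). -/
theorem UpperHalfPlane.exists_cosh_dist_add_cosh_dist (a b : UpperHalfPlane) :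
    ∃ m : UpperHalfPlane, ∀ z : UpperHalfPlane,
      Real.cosh (dist a z) + Real.cosh (dist b z) =
        2 * Real.cosh (dist a b / 2) * Real.cosh (dist m z) := by
  have ha := a.im_pos
  have hb := b.im_pos
  have hc := Real.cosh_pos (dist a b / 2)
  have hN : 4 * Real.cosh (dist a b / 2) ^ 2 * (a.im * b.im) =
      (a.re - b.re) ^ 2 + (a.im + b.im) ^ 2 := by
    have h2 := cosh_dist' a b
    rw [Real.cosh_eq_two_mul_cosh_half_sq_sub_one, eq_div_iff (by positivity)] at h2
    linarith
  generalize Real.cosh (dist a b / 2) = c at hc hN ⊢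
  refine ⟨⟨⟨(a.re * b.im + b.re * a.im) / (a.im + b.im),
    2 * c * (a.im * b.im) / (a.im + b.im)⟩, by positivity⟩, fun z => ?_⟩
  have hz := z.im_pos
  rw [cosh_dist', cosh_dist', cosh_dist']
  simp only [UpperHalfPlane.mk_re, UpperHalfPlane.mk_im]
  generalize a.im = p at *
  generalize b.im = q at *
  generalize a.re = x at *
  generalize b.re = y at *
  generalize z.im = t at *
  generalize z.re = u at *
  field_simp
  linear_combination (-p * q) * hN

/-- Any two points of the hyperbolic plane have a unique midpoint. -/
theorem UpperHalfPlane.exists_unique_midpoint (a b : UpperHalfPlane) :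
    ∃ m : UpperHalfPlane, dist a m = dist a b / 2 ∧ dist b m = dist a b / 2 ∧
      ∀ z : UpperHalfPlane, dist a z = dist a b / 2 → dist b z = dist a b / 2 → z = m := by
  obtain ⟨m, hm⟩ := UpperHalfPlane.exists_cosh_dist_add_cosh_dist a b
  have hc := Real.cosh_pos (dist a b / 2)
  have hd : 0 ≤ dist a b / 2 := by positivity
  have h1 : 1 + Real.cosh (dist a b) =
      2 * Real.cosh (dist a b / 2) * Real.cosh (dist a b / 2) := by
    rw [Real.cosh_eq_two_mul_cosh_half_sq_sub_one]
    ring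
  have key : ∀ z : UpperHalfPlane, Real.cosh (dist a z) + Real.cosh (dist b z) =
      1 + Real.cosh (dist a b) → dist z m = dist a b / 2 := by
    intro z hz
    rw [hm, h1] at hz
    rw [dist_comm]
    exact Real.cosh_injOn dist_nonneg hd (mul_left_cancel₀ (by positivity) hz)
  refine ⟨m, key a ?_, key b ?_, fun z hza hzb => ?_⟩
  · rw [dist_self, Real.cosh_zero, dist_comm b a]
  · rw [dist_self, Real.cosh_zero, add_comm]
  · have h := hm z
    rw [hza, hzb] at h
    have h2 : Real.cosh (dist m z) = Real.cosh 0 := by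
      rw [Real.cosh_zero]
      refine mul_left_cancel₀ (a := 2 * Real.cosh (dist a b / 2)) (by positivity) ?_
      linarith
    exact (dist_eq_zero.mp (Real.cosh_injOn dist_nonneg Set.self_mem_Ici h2)).symm

/-- For any `a b` in the hyperbolic plane, the function
`z ↦ dist a z ² + dist b z ²` has a unique minimizer `m`; it is the midpoint of `a` and `b`,
and the minimal value is `dist a b ² / 2`. Equivalently, `(m, m)` is the nearest point to
`(a, b)` on the diagonal of `ℍ × ℍ` for the ℓ²-product metric. -/
theorem stmt_4 (a b : UpperHalfPlane) :
    ∃ m : UpperHalfPlane,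
      (∀ z : UpperHalfPlane, dist a m ^ 2 + dist b m ^ 2 ≤ dist a z ^ 2 + dist b z ^ 2) ∧
      (∀ m' : UpperHalfPlane,
        (∀ z : UpperHalfPlane, dist a m' ^ 2 + dist b m' ^ 2 ≤ dist a z ^ 2 + dist b z ^ 2) →
        m' = m) ∧
      dist a m = dist a b / 2 ∧ dist b m = dist a b / 2 ∧
      dist a m ^ 2 + dist b m ^ 2 = dist a b ^ 2 / 2 := by
  obtain ⟨m, ha, hb, huniq⟩ := UpperHalfPlane.exists_unique_midpoint a b
  refine ⟨m, fun z => ?_, fun z hz => ?_, ha, hb, by rw [ha, hb]; ring⟩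
  · have h := dist_triangle_right a b z
    rw [ha, hb]
    nlinarith [sq_nonneg (dist a z - dist b z), dist_nonneg (x := a) (y := b)]
  · have h := dist_triangle_right a b z
    have hmin := hz m
    rw [ha, hb] at hmin
    have hd : 0 ≤ dist a b := dist_nonneg
    have h0 : (dist a z - dist a b / 2) ^ 2 + (dist b z - dist a b / 2) ^ 2 ≤ 0 := by
      nlinarith
    refine huniq z ?_ ?_
    · nlinarith [sq_nonneg (dist b z - dist a b / 2)]
    · nlinarith [sq_nonneg (dist a z - dist a b / 2)]
end

section
/- Let m ≥ 1 and let F : ℂᵐ → ℂ be holomorphic on a neighborhood of 0 (i.e. F is ℂ-analytic at 0). Assume 0 is a critical point of F, i.e. the ℂ-linear derivative of F at 0 vanishes, and that this critical point is nondegenerate: the complex Hessian H = D²F(0), viewed as a continuous ℂ-bilinear map ℂᵐ × ℂᵐ → ℂ, satisfies H(v, ·) ≠ 0 for every v ≠ 0. Then the real-valued function g(z) := Re F(z) on ℂᵐ (viewed as a real vector space) has a nondegenerate critical point at 0: the ℝ-linear derivative of g at 0 vanishes, and the real Hessian Q = D²g(0), a continuous ℝ-bilinear map, satisfies Q(v,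 ·) ≠ 0 for every v ≠ 0. -/
/-- The real-linear map sending a complex functional to its real part, a real functional. -/
noncomputable def reRestrictScalarsL (E : Type*) [NormedAddCommGroup E] [NormedSpace ℂ E]
    [NormedSpace ℝ E] [IsScalarTower ℝ ℂ E] : (E →L[ℂ] ℂ) →L[ℝ] (E →L[ℝ] ℝ) :=
  (ContinuousLinearMap.compL ℝ E ℂ ℝ Complex.reCLM).comp
    (ContinuousLinearMap.restrictScalarsL ℂ E ℂ ℝ ℝ)

section

variable {E : Type*} [NormedAddCommGroup E] [NormedSpace ℂ E] [NormedSpace ℝ E]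
  [IsScalarTower ℝ ℂ E]

theorem reRestrictScalarsL_apply (A : E →L[ℂ] ℂ) (w : E) :
    reRestrictScalarsL E A w = (A w).re := rfl

theorem reRestrictScalarsL_injective : Function.Injective (reRestrictScalarsL E) := by
  refine (injective_iff_map_eq_zero _).2 fun A hA => ?_
  have hre (w : E) : (A w).re = 0 := by
    rw [← reRestrictScalarsL_apply, hA, zero_apply]
  ext w
  refine Complex.ext (hre w) ?_
  simpa using hre (Complex.I • w)

theorem fderiv_re_eq {F : E → ℂ} {z : E} (h : DifferentiableAt ℂ F z) :
    fderiv ℝ (fun z => (F z).re) z = reRestrictScalarsL E (fderiv ℂ F z) :=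
  (Complex.reCLM.hasFDerivAt.comp z (h.hasFDerivAt.restrictScalars ℝ)).fderiv

theorem fderiv_fderiv_re_apply {F : E → ℂ} {z : E} (h : AnalyticAt ℂ F z) (v : E) :
    fderiv ℝ (fderiv ℝ (fun z => (F z).re)) z v =
      reRestrictScalarsL E (fderiv ℂ (fderiv ℂ F) z v) := by
  have heq : fderiv ℝ (fun z => (F z).re) =ᶠ[nhds z]
      reRestrictScalarsL E ∘ fderiv ℂ F :=
    h.eventually_analyticAt.mono fun y hy => fderiv_re_eq hy.differentiableAt
  have hd := h.fderiv.differentiableAt.hasFDerivAt.restrictScalars ℝ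
  rw [heq.fderiv_eq, ((reRestrictScalarsL E).hasFDerivAt.comp z hd).fderiv]
  rfl

end

/-- If `F : ℂᵐ → ℂ` is holomorphic near `0`, with `0` a nondegenerate critical
point of `F` (the complex Hessian is nondegenerate), then `g = Re F`, viewed as a real-valued
function on `ℂᵐ` as a real vector space, has a nondegenerate critical point at `0`: the real
derivative of `g` at `0` vanishes and the real Hessian of `g` at `0` is nondegenerate. -/
theorem stmt_5 (m : ℕ) (hm : 1 ≤ m)
    (F : EuclideanSpace ℂ (Fin m) → ℂ)
    (hF : AnalyticAt ℂ F 0)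
    (hcrit : fderiv ℂ F 0 = 0)
    (hnd : ∀ v : EuclideanSpace ℂ (Fin m), v ≠ 0 → fderiv ℂ (fderiv ℂ F) 0 v ≠ 0) :
    fderiv ℝ (fun z => (F z).re) 0 = 0 ∧
    ∀ v : EuclideanSpace ℂ (Fin m), v ≠ 0 →
      fderiv ℝ (fderiv ℝ (fun z => (F z).re)) 0 v ≠ 0 := by
  refine ⟨?_, fun v hv h => hnd v hv ?_⟩
  · rw [fderiv_re_eq hF.differentiableAt, hcrit, map_zero]
  · apply reRestrictScalarsL_injective
    rw [← fderiv_fderiv_re_apply hF, h, map_zero]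
end
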